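/- Suppose {a_n}_{n≥0} is periodic with minimal odd period p ≥ 1, let t_0 > 0 be fixed, let {t_n} be the solution of t_{n+1} = e^{a_n}/t_n, and define g_k(x) = t_k·x·e^{−x} for k = 0, …, 2p−1 and f = g_{2p−1} ∘ … ∘ g_0. If the map f has a non-periodic point in (0,∞), then the equation x_{n+1} = x_{n−1}·exp(a_n − x_{n−1} − x_n) has a non-periodic solution with positive initial values. -/

import Mathlib

/- compDown g k = g k ∘ g (k-1) ∘ ... ∘ g 0 -/
def compDown (g : ℕ → ℝ → ℝ) : ℕ → (ℝ → ℝ)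
  | 0 => g 0
  | k + 1 => g (k + 1) ∘ compDown g k

/-- If consecutive terms of `u` add up to an odd-periodic sequence, then `u` has twice that period. -/
theorem periodic_two_mul_of_add_eq {u a : ℕ → ℝ} {p : ℕ} (hodd : Odd p)
    (hper : Function.Periodic a p) (hu : ∀ n, u (n + 1) + u n = a n) :
    Function.Periodic u (2 * p) := by
  have alternating : ∀ n k : ℕ,
      u (n + k + p) - u (n + k) = (-1) ^ k * (u (n + p) - u n) := by
    intro n k
    induction k with
    | zero => simp
    | succ k ih =>
      have h₁ := hu (n + k + p)
      have h₂ := hu (n + k)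
      rw [hper, show n + k + p + 1 = n + (k + 1) + p by ring] at h₁
      rw [add_assoc n k 1] at h₂
      rw [pow_succ]
      linarith
  intro n
  have h := alternating n p
  rw [hodd.neg_one_pow, show n + p + p = n + 2 * p by ring] at h
  linarith

/-- If `g` is unchanged by the shift `N`, then `compDown g k` carries an orbit of `g` from time `N`
to time `N + k + 1`. -/
theorem compDown_orbit {g : ℕ → ℝ → ℝ} {X : ℕ → ℝ} {N : ℕ}
    (hX : ∀ n, X (n + 1) = g n (X n)) (hN : ∀ k, g (N + k) = g k) (k : ℕ) :
    compDown g k (X N) = X (N + k + 1) := by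
  induction k with
  | zero => rw [compDown, hX, ← hN 0, add_zero]
  | succ k ih => rw [compDown, Function.comp_apply, ih, ← hN, ← add_assoc, ← hX]

/- Statement 16 (Theorem oddgen(c)): {a_n} periodic with minimal odd period p ≥ 1, t_0 > 0
fixed, {t_n} the solution of t_{n+1} = e^{a_n}/t_n.  With g_k(x) = t_k x e^{-x} and
f = g_{2p-1} ∘ ... ∘ g_0, if f has a non-periodic point in (0,∞), then the equation (E)
has a non-periodic solution with positive initial values.  We index a solution X : ℕ → ℝ
with X n = x_{n-1}. -/
theorem stmt_16 (a : ℕ → ℝ) (p : ℕ) (hp : 1 ≤ p) (hodd : Odd p)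
    (hper : Function.Periodic a p)
    (hmin : ∀ r : ℕ, 0 < r → Function.Periodic a r → p ≤ r)
    (t : ℕ → ℝ) (ht0 : 0 < t 0)
    (htrec : ∀ n : ℕ, t (n + 1) = Real.exp (a n) / t n)
    (f : ℝ → ℝ) (hf : f = compDown (fun k x => t k * x * Real.exp (-x)) (2 * p - 1))
    (hnp : ∃ s : ℝ, 0 < s ∧ ¬ ∃ ω : ℕ, 1 ≤ ω ∧ ∀ n : ℕ, f^[n + ω] s = f^[n] s) :
    ∃ X : ℕ → ℝ, 0 < X 0 ∧ 0 < X 1 ∧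
      (∀ n : ℕ, X (n + 2) = X n * Real.exp (a n - X n - X (n + 1))) ∧
      ¬ ∃ m : ℕ, 1 ≤ m ∧ ∀ n : ℕ, X (n + m) = X n := by
  obtain ⟨s, hs, hns⟩ := hnp
  have ht : ∀ n, 0 < t n := by
    intro n
    induction n with
    | zero => exact ht0
    | succ n ih => rw [htrec]; positivity
  have hlog : Function.Periodic (fun n => Real.log (t n)) (2 * p) := by
    refine periodic_two_mul_of_add_eq hodd hper fun n => ?_
    rw [htrec, Real.log_div (Real.exp_ne_zero _) (ht n).ne', Real.log_exp]
    ring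
  have htper : Function.Periodic t (2 * p) := fun n =>
    Real.log_injOn_pos (ht _) (ht _) (hlog n)
  let X : ℕ → ℝ := fun n => n.rec s fun k x => t k * x * Real.exp (-x)
  have hX : ∀ n, X (n + 1) = t n * X n * Real.exp (-X n) := fun _ => rfl
  have hpos : ∀ n, 0 < X n := by
    intro n
    induction n with
    | zero => exact hs
    | succ n ih => have := ht n; rw [hX]; positivity
  have horbit : ∀ k, f^[k] s = X (k * (2 * p)) := by
    intro k
    induction k with
    | zero => simp [X]
    | succ k ih =>
      rw [Function.iterate_succ_apply', ih, hf,
        compDown_orbit (g := fun k x => t k * x * Real.exp (-x)) (X := X) hX]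
      · have h : k * (2 * p) + (2 * p - 1) + 1 = (k + 1) * (2 * p) := by
          rw [add_one_mul]
          omega
        rw [h]
      · intro j
        have h := htper.nat_mul k j
        rw [Nat.cast_id] at h
        rw [add_comm, h]
  refine ⟨X, hpos 0, hpos 1, fun n => ?_, ?_⟩
  · have := (ht n).ne'
    rw [hX (n + 1), htrec, sub_eq_add_neg, sub_eq_add_neg, Real.exp_add, Real.exp_add]
    nth_rewrite 1 [hX n]
    field_simp
  · rintro ⟨m, hm, hXm⟩
    refine hns ⟨m, hm, fun n => ?_⟩
    have h := (show Function.Periodic X m from hXm).nat_mul (2 * p) (n * (2 * p))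
    rw [Nat.cast_id] at h
    rw [horbit, horbit, ← h]
    congr 1
    ring
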